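/- arXiv:math/0312501 — 5 statements merged into one kernel-verified Lean document; each statement's English description precedes it below -/
import Mathlib

section
/- Let A be a unital C*-algebra and let z ∈ A with ‖z‖ ≤ 1. Let s := (1 − z z*)^{1/2} be the positive square root of the positive element 1 − z z*. Define π : A → M₂(A) (2×2 matrices over A with its C*-algebra norm) by π(x) := [[x z, x s], [0, 0]]. Then π(x₁) π(x₂) = π(x₁ z x₂) for all x₁, x₂ ∈ A (so π is an algebra homomorphism from A equipped with the product m_z(x₁,x₂) := x₁ z x₂ into M₂(A)), and ‖π(x)‖ = ‖x‖ for all x ∈ A (so π is isometric). -/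
open Matrix

/-- A function `N` is a C⋆-norm if it is a (not necessarily complete) submultiplicative norm
satisfying the C⋆-identity. -/
structure IsCStarNorm {B : Type*} [Ring B] [Star B] [Module ℂ B] (N : B → ℝ) : Prop where
  eq_zero_iff : ∀ a, N a = 0 ↔ a = 0
  add_le : ∀ a b, N (a + b) ≤ N a + N b
  smul : ∀ (c : ℂ) a, N (c • a) = ‖c‖ * N a
  mul_le : ∀ a b, N (a * b) ≤ N a * N b
  star_mul_self : ∀ a, N (star a * a) = N a * N a

namespace IsCStarNorm

section StarRing

variable {B : Type*} [Ring B] [StarRing B] [Module ℂ B] {N : B → ℝ}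

lemma map_zero (hN : IsCStarNorm N) : N 0 = 0 := (hN.eq_zero_iff 0).2 rfl

lemma map_neg (hN : IsCStarNorm N) (a : B) : N (-a) = N a := by
  simpa using hN.smul (-1) a

lemma nonneg (hN : IsCStarNorm N) (a : B) : 0 ≤ N a := by
  have h := hN.add_le a (-a)
  rw [add_neg_cancel, hN.map_zero, hN.map_neg] at h
  linarith

lemma le_map_star (hN : IsCStarNorm N) (a : B) : N a ≤ N (star a) := by
  have h := (hN.star_mul_self a).symm.trans_le (hN.mul_le (star a) a)
  rcases (hN.nonneg a).eq_or_lt with h0 | h0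
  · exact h0 ▸ hN.nonneg (star a)
  · exact le_of_mul_le_mul_right h h0

lemma map_star (hN : IsCStarNorm N) (a : B) : N (star a) = N a :=
  le_antisymm (by simpa using hN.le_map_star (star a)) (hN.le_map_star a)

lemma mul_star_self (hN : IsCStarNorm N) (a : B) : N (a * star a) = N a * N a := by
  simpa [hN.map_star] using hN.star_mul_self (star a)

lemma map_one_le (hN : IsCStarNorm N) : N 1 ≤ 1 := by
  have h := hN.star_mul_self 1
  rw [star_one, mul_one] at h
  nlinarith [hN.nonneg 1]

lemma map_unitary_le (hN : IsCStarNorm N) (u : unitary B) : N u ≤ 1 := by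
  have h := hN.star_mul_self (u : B)
  rw [Unitary.coe_star_mul_self] at h
  nlinarith [hN.map_one_le]

/-- A C⋆-norm on `2 × 2` matrices restricts to a C⋆-norm on the upper left corner. -/
lemma matrixCorner {Nm : Matrix (Fin 2) (Fin 2) B → ℝ} (hN : IsCStarNorm Nm) :
    IsCStarNorm fun a : B ↦ Nm !![a, 0; 0, 0] where
  eq_zero_iff a := by
    rw [hN.eq_zero_iff]
    refine ⟨fun h ↦ by simpa using congr_fun₂ h 0 0, ?_⟩
    rintro rfl
    ext i j
    fin_cases i <;> fin_cases j <;> rfl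
  add_le a b := by simpa using hN.add_le !![a, 0; 0, 0] !![b, 0; 0, 0]
  smul c a := by simpa using hN.smul c !![a, 0; 0, 0]
  mul_le a b := by
    simpa only [mul_fin_two, mul_zero, zero_mul, add_zero]
      using hN.mul_le !![a, 0; 0, 0] !![b, 0; 0, 0]
  star_mul_self a := by
    have h : star !![a, 0; 0, 0] = !![star a, 0; 0, 0] := by
      ext i j
      fin_cases i <;> fin_cases j <;> simp [Matrix.star_apply]
    simpa only [h, mul_fin_two, mul_zero, zero_mul, add_zero]
      using hN.star_mul_self !![a, 0; 0, 0]

end StarRing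

section Ordered

variable {A : Type*} [CStarAlgebra A] [PartialOrder A] [StarOrderedRing A] {N : A → ℝ}

lemma le_norm_of_isSelfAdjoint (hN : IsCStarNorm N) {a : A} (ha : IsSelfAdjoint a) :
    N a ≤ ‖a‖ := by
  have unit_ball (b : selfAdjoint A) (hb : ‖b‖ ≤ 1) : N b ≤ 1 := by
    set u := selfAdjoint.unitarySelfAddISMul b hb with hu
    have hb' : (b : A) = (2⁻¹ : ℂ) • ((u : A) + star (u : A)) := by
      rw [hu, selfAdjoint.star_coe_unitarySelfAddISMul]
      simp only [selfAdjoint.unitarySelfAddISMul, add_add_sub_cancel, ← two_smul ℂ (b : A),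
        smul_smul]
      norm_num
    have h := hN.add_le (u : A) (star (u : A))
    rw [hN.map_star] at h
    rw [hb', hN.smul]
    norm_num
    linarith [hN.map_unitary_le u]
  rcases eq_or_ne a 0 with rfl | ha0
  · simp [hN.map_zero]
  have hpos := norm_pos_iff.2 ha0
  have h := unit_ball (‖a‖⁻¹ • ⟨a, ha⟩) (by
    change ‖‖a‖⁻¹ • a‖ ≤ 1
    simp [norm_smul, hpos.ne'])
  change N (‖a‖⁻¹ • a) ≤ 1 at h
  rw [← Complex.coe_smul, hN.smul, Complex.norm_real, norm_inv, norm_norm,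
    inv_mul_le_iff₀ hpos, mul_one] at h
  exact h

lemma norm_le_of_nonneg (hN : IsCStarNorm N) {a : A} (ha : 0 ≤ a) : ‖a‖ ≤ N a := by
  by_contra! hlt
  obtain ⟨c, hNc, hca⟩ := exists_between hlt
  have hc : 0 < c := (hN.nonneg a).trans_lt hNc
  have : Nontrivial A := nontrivial_of_ne a 0 (norm_pos_iff.1 (hc.trans hca))
  have hm (t : ℝ) : 0 < max t c := hc.trans_le (le_max_right t c)
  have ha' : IsSelfAdjoint a := .of_nonneg ha
  let f : ℝ → ℝ := fun t ↦ max (t - c) 0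
  let k : ℝ → ℝ := fun t ↦ (max t c)⁻¹
  have hf : Continuous f := by fun_prop
  have hk : Continuous k := Continuous.inv₀ (by fun_prop) fun t ↦ (hm t).ne'
  have hfac : cfc f a = cfc f a * (a * cfc k a) := by
    conv_rhs => enter [2, 1]; rw [← cfc_id' ℝ a]
    rw [← cfc_mul _ k a, ← cfc_mul f _ a]
    congr 1
    ext t
    rcases le_total t c with h | h
    · simp [f, h]
    · simp [k, h, (hc.trans_le h).ne']
  have hkN : N (cfc k a) ≤ c⁻¹ := by
    refine (hN.le_norm_of_isSelfAdjoint (cfc_predicate k a)).trans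
      (norm_cfc_le (by positivity) fun t _ ↦ ?_)
    rw [Real.norm_of_nonneg (inv_nonneg.2 (hm t).le)]
    exact inv_anti₀ hc (le_max_right t c)
  have hfN : 0 < N (cfc f a) := by
    refine (hN.nonneg _).lt_of_ne' fun h ↦ ?_
    have h' := norm_apply_le_norm_cfc f a (CStarAlgebra.norm_mem_spectrum_of_nonneg ha)
    rw [(hN.eq_zero_iff _).1 h, norm_zero] at h'
    have h'' := (le_max_left _ _).trans ((Real.le_norm_self _).trans h')
    linarith
  have hak : N (a * cfc k a) < 1 := calc
    _ ≤ N a * c⁻¹ := (hN.mul_le _ _).trans (mul_le_mul_of_nonneg_left hkN (hN.nonneg a))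
    _ < c * c⁻¹ := by gcongr
    _ = 1 := mul_inv_cancel₀ hc.ne'
  have h := hN.mul_le (cfc f a) (a * cfc k a)
  rw [← hfac] at h
  nlinarith

end Ordered

/-- Every C⋆-norm on a C⋆-algebra is equal to its norm, even without assuming completeness. -/
theorem eq_norm {A : Type*} [CStarAlgebra A] {N : A → ℝ} (hN : IsCStarNorm N) (a : A) : N a = ‖a‖ := by
  let := CStarAlgebra.spectralOrder A
  have := CStarAlgebra.spectralOrderedRing A
  have h := le_antisymm (hN.le_norm_of_isSelfAdjoint (IsSelfAdjoint.star_mul_self a))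
    (hN.norm_le_of_nonneg (star_mul_self_nonneg a))
  rw [hN.star_mul_self, CStarRing.norm_star_mul_self] at h
  exact (mul_self_inj (hN.nonneg a) (norm_nonneg a)).1 h

end IsCStarNorm

/-- Let `A` be a unital C*-algebra, `z ∈ A` with `‖z‖ ≤ 1`, and let `s = (1 - z z*)^{1/2}`
be the positive square root of `1 - z z*`.  Then `π(x) = [[xz, xs], [0, 0]]` defines an
algebra homomorphism from `(A, m_z)` into `M₂(A)` which is isometric for the (unique)
C*-norm `Nm` on `M₂(A)`. -/
theorem stmt_4 (A : Type*) [CStarAlgebra A] [PartialOrder A] [StarOrderedRing A]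
    (z : A) (hz : ‖z‖ ≤ 1)
    (s : A) (hs_nonneg : 0 ≤ s) (hs_sq : s * s = 1 - z * star z)
    -- `Nm` is the C*-algebra norm on `M₂(A)` (such a norm is unique):
    (Nm : Matrix (Fin 2) (Fin 2) A → ℝ)
    (hNm_zero : ∀ M, Nm M = 0 ↔ M = 0)
    (hNm_add : ∀ M N, Nm (M + N) ≤ Nm M + Nm N)
    (hNm_smul : ∀ (c : ℂ) M, Nm (c • M) = ‖c‖ * Nm M)
    (hNm_mul : ∀ M N, Nm (M * N) ≤ Nm M * Nm N)
    (hNm_cstar : ∀ M, Nm (Mᴴ * M) = Nm M * Nm M)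
    (π : A → Matrix (Fin 2) (Fin 2) A)
    (hπ : ∀ x, π x = !![x * z, x * s; 0, 0]) :
    (∀ x₁ x₂ : A, π x₁ * π x₂ = π (x₁ * z * x₂)) ∧
    (∀ x : A, Nm (π x) = ‖x‖) := by
  have hNm : IsCStarNorm Nm := ⟨hNm_zero, hNm_add, hNm_smul, hNm_mul, hNm_cstar⟩
  refine ⟨fun x₁ x₂ ↦ by
    simp only [hπ, mul_fin_two, mul_zero, zero_mul, add_zero, mul_assoc], fun x ↦ ?_⟩
  have hs : star s = s := (IsSelfAdjoint.of_nonneg hs_nonneg).star_eq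
  have hstar : star (π x) = !![star z * star x, 0; s * star x, 0] := by
    ext i j
    fin_cases i <;> fin_cases j <;> simp [hπ, Matrix.star_apply, hs]
  have hcorner : π x * star (π x) = !![x * star x, 0; 0, 0] := by
    have h : x * z * (star z * star x) + x * s * (s * star x) = x * star x := calc
      _ = x * (z * star z + s * s) * star x := by noncomm_ring
      _ = x * star x := by rw [hs_sq, add_sub_cancel, mul_one]
    rw [hstar, hπ, mul_fin_two]
    simp only [h, mul_zero, zero_mul, add_zero]
  have h := hNm.mul_star_self (π x)
  rw [hcorner, hNm.matrixCorner.eq_norm, CStarRing.norm_self_mul_star] at h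
  exact ((mul_self_inj (norm_nonneg x) (hNm.nonneg _)).1 h).symm
end

section
/- Let A be a unital C*-algebra, let r > 0, and let z ∈ A with ‖z‖ ≤ r. Let s := (r² − z z*)^{1/2} be the positive square root of the positive element r²·1 − z z*. Define π : A → M₂(A) by π(x) := [[x z, x s], [0, 0]]. Then π(x₁) π(x₂) = π(x₁ z x₂) for all x₁, x₂ ∈ A, and ‖π(x)‖ = r ‖x‖ for all x ∈ A; that is, π is an algebra homomorphism from A with the product m_z(x₁,x₂) := x₁ z x₂ into M₂(A) which is r times a (linear) isometry. -/
open Matrix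

/-- A norm on a complex `*`-algebra, as a bare function, satisfying the C⋆-identity.
Completeness is not required. -/
structure IsCStarNorm_s5 {B : Type*} [Ring B] [StarRing B] [Module ℂ B] (p : B → ℝ) : Prop where
  eq_zero_iff : ∀ a, p a = 0 ↔ a = 0
  add_le : ∀ a b, p (a + b) ≤ p a + p b
  smul : ∀ (c : ℂ) a, p (c • a) = ‖c‖ * p a
  mul_le : ∀ a b, p (a * b) ≤ p a * p b
  star_mul_self : ∀ a, p (star a * a) = p a * p a

namespace IsCStarNorm_s5

section General

variable {B : Type*} [Ring B] [StarRing B] [Module ℂ B] {p : B → ℝ}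

lemma nonneg_s5 (hp : IsCStarNorm_s5 p) (a : B) : 0 ≤ p a := by
  have h := hp.add_le a ((-1 : ℂ) • a)
  rw [hp.smul, neg_one_smul, add_neg_cancel, (hp.eq_zero_iff 0).2 rfl] at h
  simp only [norm_neg, norm_one, one_mul] at h
  linarith

lemma le_star (hp : IsCStarNorm_s5 p) (a : B) : p a ≤ p (star a) := by
  rcases (hp.nonneg_s5 a).eq_or_lt with h | h
  · exact h ▸ hp.nonneg_s5 _
  · refine le_of_mul_le_mul_right ?_ h
    exact (hp.star_mul_self a).symm.trans_le (hp.mul_le _ _)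

lemma star (hp : IsCStarNorm_s5 p) (a : B) : p (star a) = p a :=
  le_antisymm (by simpa using hp.le_star (Star.star a)) (hp.le_star a)

lemma self_mul_star (hp : IsCStarNorm_s5 p) (a : B) : p (a * Star.star a) = p a * p a := by
  simpa [hp.star] using hp.star_mul_self (Star.star a)

lemma one_le_one (hp : IsCStarNorm_s5 p) : p 1 ≤ 1 := by
  have h := hp.star_mul_self 1
  rw [star_one, one_mul] at h
  nlinarith

lemma unitary_le_one (hp : IsCStarNorm_s5 p) (u : unitary B) : p (u : B) ≤ 1 := by
  have h := hp.star_mul_self (u : B)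
  rw [Unitary.coe_star_mul_self] at h
  nlinarith [hp.one_le_one, hp.nonneg_s5 (u : B)]

end General

variable {A : Type*} [CStarAlgebra A] {p : A → ℝ}

lemma real_smul (hp : IsCStarNorm_s5 p) (c : ℝ) (a : A) : p (c • a) = |c| * p a := by
  rw [← Complex.coe_smul, hp.smul, Complex.norm_real, Real.norm_eq_abs]

section Order

variable [PartialOrder A] [StarOrderedRing A]

lemma le_one_of_isSelfAdjoint (hp : IsCStarNorm_s5 p) {a : A} (ha : IsSelfAdjoint a)
    (ha_norm : ‖a‖ ≤ 1) : p a ≤ 1 := by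
  let u := selfAdjoint.unitarySelfAddISMul ⟨a, ha⟩ ha_norm
  have hu : a = (2⁻¹ : ℝ) • ((u : A) + ((Star.star u : unitary A) : A)) := by
    rw [Unitary.coe_star, ← realPart_apply_coe (u : A)]
    exact congrArg Subtype.val (selfAdjoint.realPart_unitarySelfAddISMul ⟨a, ha⟩ ha_norm).symm
  rw [hu, hp.real_smul, abs_of_pos (by norm_num)]
  linarith [hp.add_le (u : A) (Star.star u : unitary A), hp.unitary_le_one u,
    hp.unitary_le_one (Star.star u)]

lemma le_norm_of_isSelfAdjoint_s5 (hp : IsCStarNorm_s5 p) {a : A} (ha : IsSelfAdjoint a) :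
    p a ≤ ‖a‖ := by
  rcases eq_or_ne a 0 with rfl | h0
  · simp [(hp.eq_zero_iff 0).2 rfl]
  have h0' : 0 < ‖a‖ := norm_pos_iff.2 h0
  have h := hp.le_one_of_isSelfAdjoint (a := ‖a‖⁻¹ • a) ((IsSelfAdjoint.all _).smul ha)
    (by simp [norm_smul, h0'.ne'])
  rw [hp.real_smul, abs_of_pos (by positivity), inv_mul_le_iff₀ h0', mul_one] at h
  exact h

lemma norm_le_of_lt (hp : IsCStarNorm_s5 p) {a : A} (ha : 0 ≤ a) {δ : ℝ} (hδ : p a < δ) :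
    ‖a‖ ≤ δ := by
  have hδ0 : 0 < δ := (hp.nonneg_s5 a).trans_lt hδ
  have hmax (t : ℝ) : 0 < max t δ := lt_max_of_lt_right hδ0
  have hg : Continuous fun t : ℝ => (max t δ)⁻¹ :=
    (continuous_id.max continuous_const).inv₀ fun t => (hmax t).ne'
  set e : A := cfc (fun t : ℝ => max (t - δ) 0) a with he
  set d : A := cfc (fun t : ℝ => (max t δ)⁻¹) a
  have hd_norm : p d ≤ δ⁻¹ := by
    refine (hp.le_norm_of_isSelfAdjoint_s5 (cfc_predicate _ a)).trans
      (norm_cfc_le (by positivity) fun t _ => ?_)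
    rw [Real.norm_of_nonneg (inv_nonneg.2 (hmax t).le)]
    exact inv_anti₀ hδ0 (le_max_right _ _)
  have had : a * d = cfc (fun t : ℝ => t * (max t δ)⁻¹) a := by
    rw [cfc_mul (fun t : ℝ => t) _ a (by fun_prop) hg.continuousOn, cfc_id' ℝ a]
  have hmul : e = e * (a * d) := by
    rw [had, he, ← cfc_mul (fun t : ℝ => max (t - δ) 0) (fun t : ℝ => t * (max t δ)⁻¹) a
      (by fun_prop) (continuous_id.mul hg).continuousOn]
    refine cfc_congr fun t _ => ?_
    rcases le_total t δ with h | h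
    · simp [max_eq_right (sub_nonpos.2 h)]
    · simp [max_eq_left h, (hδ0.trans_le h).ne']
  have hpad : p (a * d) < 1 :=
    calc p (a * d) ≤ p a * δ⁻¹ :=
          (hp.mul_le a d).trans (mul_le_mul_of_nonneg_left hd_norm (hp.nonneg_s5 a))
      _ < 1 := by rwa [← div_eq_mul_inv, div_lt_one hδ0]
  have he0 : e = 0 := by
    have h := hp.mul_le e (a * d)
    rw [← hmul] at h
    exact (hp.eq_zero_iff e).1 (by nlinarith [hp.nonneg_s5 e])
  rw [← cfc_id' ℝ a ha.isSelfAdjoint]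
  refine norm_cfc_le hδ0.le fun t ht => ?_
  have h := norm_apply_le_norm_cfc (fun t : ℝ => max (t - δ) 0) a ht (by fun_prop)
    ha.isSelfAdjoint
  rw [← he, he0, norm_zero, norm_le_zero_iff] at h
  rw [Real.norm_of_nonneg (spectrum_nonneg_of_nonneg ha ht)]
  linarith [le_max_left (t - δ) 0]

/-- A C⋆-norm on a C⋆-algebra, complete or not, is the given norm. -/
theorem eq_norm_s5 (hp : IsCStarNorm_s5 p) (a : A) : p a = ‖a‖ := by
  have h : p (Star.star a * a) = ‖Star.star a * a‖ :=
    le_antisymm (hp.le_norm_of_isSelfAdjoint_s5 (.star_mul_self a))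
      (le_of_forall_gt_imp_ge_of_dense fun δ hδ => hp.norm_le_of_lt (star_mul_self_nonneg a) hδ)
  rw [hp.star_mul_self, CStarRing.norm_star_mul_self] at h
  exact (mul_self_inj (hp.nonneg_s5 a) (norm_nonneg a)).1 h

end Order

/-- A C⋆-norm on a matrix algebra restricts to a C⋆-norm on each diagonal corner. -/
lemma comp_single {n : Type*} [Fintype n] [DecidableEq n] {N : Matrix n n A → ℝ}
    (hN : IsCStarNorm_s5 N) (i : n) : IsCStarNorm_s5 fun a : A => N (single i i a) where
  eq_zero_iff a := (hN.eq_zero_iff _).trans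
    ⟨fun h => by simpa using congrFun₂ h i i, fun h => by simp [h]⟩
  add_le a b := by simpa [single_add] using hN.add_le (single i i a) (single i i b)
  smul c a := by simpa [smul_single] using hN.smul c (single i i a)
  mul_le a b := by simpa using hN.mul_le (single i i a) (single i i b)
  star_mul_self a := by
    simpa [star_eq_conjTranspose, conjTranspose_single] using hN.star_mul_self (single i i a)

end IsCStarNorm_s5

/-- Let `A` be a unital C*-algebra, `r > 0`, `z ∈ A` with `‖z‖ ≤ r`, and let
`s = (r² - z z*)^{1/2}` be the positive square root of `r²·1 - z z*`.  Then
`π(x) = [[xz, xs], [0, 0]]` is an algebra homomorphism from `(A, m_z)` into `M₂(A)`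
which is `r` times an isometry for the (unique) C*-norm `Nm` on `M₂(A)`. -/
theorem stmt_5 (A : Type*) [CStarAlgebra A] [PartialOrder A] [StarOrderedRing A]
    (r : ℝ) (hr : 0 < r) (z : A) (hz : ‖z‖ ≤ r)
    (s : A) (hs_nonneg : 0 ≤ s) (hs_sq : s * s = (r ^ 2 : ℝ) • (1 : A) - z * star z)
    -- `Nm` is the C*-algebra norm on `M₂(A)` (such a norm is unique):
    (Nm : Matrix (Fin 2) (Fin 2) A → ℝ)
    (hNm_zero : ∀ M, Nm M = 0 ↔ M = 0)
    (hNm_add : ∀ M N, Nm (M + N) ≤ Nm M + Nm N)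
    (hNm_smul : ∀ (c : ℂ) M, Nm (c • M) = ‖c‖ * Nm M)
    (hNm_mul : ∀ M N, Nm (M * N) ≤ Nm M * Nm N)
    (hNm_cstar : ∀ M, Nm (Mᴴ * M) = Nm M * Nm M)
    (π : A → Matrix (Fin 2) (Fin 2) A)
    (hπ : ∀ x, π x = !![x * z, x * s; 0, 0]) :
    (∀ x₁ x₂ : A, π x₁ * π x₂ = π (x₁ * z * x₂)) ∧
    (∀ x : A, Nm (π x) = r * ‖x‖) := by
  have hN : IsCStarNorm_s5 Nm := ⟨hNm_zero, hNm_add, hNm_smul, hNm_mul, hNm_cstar⟩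
  refine ⟨fun x₁ x₂ => ?_, fun x => ?_⟩
  · ext i j
    fin_cases i <;> fin_cases j <;> simp [hπ, mul_assoc]
  have hs : star s = s := hs_nonneg.isSelfAdjoint
  have hxx : x * z * (star z * star x) + x * s * (s * star x) = (r ^ 2 : ℝ) • (x * star x) :=
    calc _ = x * (z * star z + s * s) * star x := by noncomm_ring
      _ = _ := by rw [hs_sq]; simp
  have hππ : π x * star (π x) = single 0 0 ((r ^ 2 : ℝ) • (x * star x)) := by
    rw [hπ, ← hxx]
    ext i j
    fin_cases i <;> fin_cases j <;> simp [star_eq_conjTranspose, mul_apply, hs]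
  have h := hN.self_mul_star (π x)
  rw [hππ, (hN.comp_single 0).eq_norm_s5, norm_smul, CStarRing.norm_self_mul_star,
    Real.norm_of_nonneg (by positivity)] at h
  refine (mul_self_inj (hN.nonneg_s5 _) (by positivity)).1 ?_
  rw [← h]
  ring
end

section
/- Let A be a unital C*-algebra and let z, e ∈ A satisfy ‖z‖ ≤ 1, ‖e‖ ≤ 1, and z e = 1. Then e = z*, and consequently z z* = 1 and e* e = 1. -/
/-- A contraction `a` in a unital C*-algebra satisfies `a* a ≤ 1`. -/
theorem star_mul_self_le_one_of_norm_le_one {A : Type*} [CStarAlgebra A] [PartialOrder A]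
    [StarOrderedRing A] {a : A} (ha : ‖a‖ ≤ 1) : star a * a ≤ 1 := by
  rw [← CStarAlgebra.norm_le_one_iff_of_nonneg (star a * a) (star_mul_self_nonneg a),
    CStarRing.norm_star_mul_self]
  exact mul_le_one₀ ha (norm_nonneg a) ha

/-- In a unital C*-algebra, if `‖z‖ ≤ 1`, `‖e‖ ≤ 1` and `z e = 1`, then `e = z*`,
and consequently `z z* = 1` and `e* e = 1`. -/
theorem stmt_6 (A : Type*) [CStarAlgebra A] (z e : A)
    (hz : ‖z‖ ≤ 1) (he : ‖e‖ ≤ 1) (hze : z * e = 1) :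
    e = star z ∧ z * star z = 1 ∧ star e * e = 1 := by
  let _ := CStarAlgebra.spectralOrder A
  have := CStarAlgebra.spectralOrderedRing A
  have hzz : z * star z ≤ 1 := by
    simpa using star_mul_self_le_one_of_norm_le_one (a := star z) (by rwa [norm_star])
  have hee : star e * e ≤ 1 := star_mul_self_le_one_of_norm_le_one he
  have hez : star e * star z = 1 := by rw [← star_mul, hze, star_one]
  have expand : star (e - star z) * (e - star z) = (star e * e - 1) + (z * star z - 1) := by
    rw [star_sub, star_star, sub_mul, mul_sub, mul_sub, hez, hze]
    abel
  have nonpos : star (e - star z) * (e - star z) ≤ 0 := by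
    rw [expand]
    exact add_nonpos (sub_nonpos.2 hee) (sub_nonpos.2 hzz)
  have h : e = star z := by
    rw [← sub_eq_zero, ← CStarRing.star_mul_self_eq_zero_iff]
    exact le_antisymm nonpos (star_mul_self_nonneg _)
  subst h
  exact ⟨rfl, hze, by rwa [star_star]⟩
end

section
/- Let n be a natural number and let A, B, C, D ∈ Mₙ(ℂ). If AᴴA + BᴴB ≤ I and CᴴC + DᴴD ≤ I in the Loewner order, then (AC)ᴴ(AC) + (BD)ᴴ(BD) ≤ I. (Equivalently: 0 ≤ CᴴAᴴAC + DᴴBᴴBD ≤ CᴴC + DᴴD ≤ I.) This shows that the product m₁((a,b),(c,d)) := (ac, bd) on the column space C₂ is completely contractive. -/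
open Matrix
open scoped ComplexOrder

/-- If `AᴴA + BᴴB ≤ I` and `CᴴC + DᴴD ≤ I` in the Loewner order (expressed via positive
semidefiniteness of the differences), then `(AC)ᴴ(AC) + (BD)ᴴ(BD) ≤ I`.  This shows that
the product `m₁((a,b),(c,d)) = (ac, bd)` on the column space `C₂` is completely
contractive. -/
theorem stmt_7 (n : ℕ) (A B C D : Matrix (Fin n) (Fin n) ℂ)
    (hAB : ((1 : Matrix (Fin n) (Fin n) ℂ) - (Aᴴ * A + Bᴴ * B)).PosSemidef)
    (hCD : ((1 : Matrix (Fin n) (Fin n) ℂ) - (Cᴴ * C + Dᴴ * D)).PosSemidef) :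
    ((1 : Matrix (Fin n) (Fin n) ℂ) - ((A * C)ᴴ * (A * C) + (B * D)ᴴ * (B * D))).PosSemidef := by
  have key : (1 : Matrix (Fin n) (Fin n) ℂ) - ((A * C)ᴴ * (A * C) + (B * D)ᴴ * (B * D)) =
      (1 - (Cᴴ * C + Dᴴ * D)) + (Cᴴ * (1 - (Aᴴ * A + Bᴴ * B)) * C + (B * C)ᴴ * (B * C)) +
        (Dᴴ * (1 - (Aᴴ * A + Bᴴ * B)) * D + (A * D)ᴴ * (A * D)) := by
    simp only [conjTranspose_mul]
    noncomm_ring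
  rw [key]
  exact (hCD.add ((hAB.conjTranspose_mul_mul_same C).add
    (posSemidef_conjTranspose_mul_self _))).add
      ((hAB.conjTranspose_mul_mul_same D).add (posSemidef_conjTranspose_mul_self _))
end

section
/- Let A be an associative unital ℂ-algebra, let X be a left A-module on which A acts faithfully (i.e., if a • x = a' • x for all x ∈ X then a = a'), and let γ : X → A be a linear map. Define the bilinear map m : X × X → X by m(x, y) := γ(x) • y. Then m is associative (m(m(x,y),w) = m(x,m(y,w)) for all x,y,w ∈ X) if and only if γ(γ(x) • y) = γ(x) γ(y) for all x, y ∈ X (i.e., γ is a left quasihomomorphism). In that case γ(m(x,y)) = γ(x)γ(y), so γ is an algebra homomorphism from (X, m) into A. -/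
/-- Let `A` be a unital complex algebra acting faithfully on a module `X`, and let
`γ : X → A` be linear.  The bilinear map `m(x, y) = γ(x) • y` is associative if and only
if `γ` is a left quasihomomorphism, i.e. `γ(γ(x) • y) = γ(x) γ(y)` for all `x, y`; and in
that case `γ` is an algebra homomorphism from `(X, m)` into `A`. -/
theorem stmt_11 (A X : Type*) [Ring A] [Algebra ℂ A]
    [AddCommGroup X] [Module ℂ X] [Module A X]
    (hfaithful : ∀ a a' : A, (∀ x : X, a • x = a' • x) → a = a')
    (γ : X →ₗ[ℂ] A) (m : X → X → X)
    (hm : ∀ x y, m x y = γ x • y) :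
    ((∀ x y w : X, m (m x y) w = m x (m y w)) ↔
      (∀ x y : X, γ (γ x • y) = γ x * γ y)) ∧
    ((∀ x y : X, γ (γ x • y) = γ x * γ y) →
      ∀ x y : X, γ (m x y) = γ x * γ y) := by
  simp only [hm]
  refine ⟨⟨fun h x y => hfaithful _ _ fun w => ?_, fun h x y w => ?_⟩, id⟩
  · rw [h, mul_smul]
  · rw [h, mul_smul]
end
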